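/- Let A be a Cohen–Macaulay local ring and let M and N be nonzero finitely generated Tor-independent A-modules such that M has reducible complexity. If depth (M ⊗_A N) > 0, then depth M > 0. -/

import Mathlib

open IsLocalRing CategoryTheory

universe u

noncomputable section

/-! Basic commutative-algebra notions: depth, minimal free resolutions, Betti numbers,
complexity, syzygies, reducible complexity, upper reducing degree, Tor-independence,
Gorenstein dimension, CI-dimension, Cohen-Macaulay local rings. -/




/-- The depth of a module over a local ring: the supremum of lengths of regular
sequences on the module consisting of elements of the maximal ideal. -/
def moduleDepth (A : Type u) [CommRing A] [IsLocalRing A]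
    (M : Type u) [AddCommGroup M] [Module A M] : ℕ∞ :=
  sSup {n : ℕ∞ | ∃ rs : List A, (rs.length : ℕ∞) = n ∧
    (∀ x ∈ rs, x ∈ maximalIdeal A) ∧ RingTheory.Sequence.IsRegular M rs}

/-- A minimal free resolution of a module over a local ring. -/
structure MinFreeRes (A : Type u) [CommRing A] [IsLocalRing A]
    (M : Type u) [AddCommGroup M] [Module A M] : Type (u + 1) where
  F : ℕ → ModuleCat.{u} A
  free : ∀ n, Module.Free A (F n)
  fin : ∀ n, Module.Finite A (F n)
  d : ∀ n, F (n + 1) →ₗ[A] F n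
  aug : F 0 →ₗ[A] M
  aug_surj : Function.Surjective aug
  exact_aug : Function.Exact (d 0) aug
  exact_d : ∀ n, Function.Exact (d (n + 1)) (d n)
  minimal : ∀ n x, d n x ∈ (maximalIdeal A) • (⊤ : Submodule A (F n))

/-- The Betti numbers of a minimal free resolution. -/
def MinFreeRes.betti {A : Type u} [CommRing A] [IsLocalRing A]
    {M : Type u} [AddCommGroup M] [Module A M] (R : MinFreeRes A M) (n : ℕ) : ℕ :=
  Module.finrank A (R.F n)

/-- The sequence `β` is eventually bounded by `a * n ^ (t - 1)` for some real `a`. -/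
def CxBound (β : ℕ → ℕ) (t : ℕ) : Prop :=
  ∃ a : ℝ, ∃ N : ℕ, ∀ n, N ≤ n → (β n : ℝ) ≤ a * (n : ℝ) ^ ((t : ℝ) - 1)

/-- The complexity of a module: the least `t` such that the Betti sequence of a minimal
free resolution is eventually bounded by `a * n ^ (t - 1)` for some `a` (and `⊤` if no
such `t` exists). -/
def complexity (A : Type u) [CommRing A] [IsLocalRing A]
    (M : Type u) [AddCommGroup M] [Module A M] : ℕ∞ :=
  sInf {t : ℕ∞ | ∃ t' : ℕ, t = (t' : ℕ∞) ∧ ∃ R : MinFreeRes A M, CxBound R.betti t'}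

/-- A finite resolution of a module `M`:
an exact sequence `0 → G len → ⋯ → G 0 → M → 0`. -/
structure FinRes (A : Type u) [CommRing A]
    (M : Type u) [AddCommGroup M] [Module A M] : Type (u + 1) where
  len : ℕ
  G : ℕ → ModuleCat.{u} A
  d : ∀ n, G (n + 1) →ₗ[A] G n
  aug : G 0 →ₗ[A] M
  bounded : ∀ n, len < n → Subsingleton (G n)
  aug_surj : Function.Surjective aug
  exact_aug : Function.Exact (d 0) aug
  exact_d : ∀ n, Function.Exact (d (n + 1)) (d n)

/-- A module has finite projective dimension if it admits a finite resolution by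
projective modules. -/
def HasFiniteProjDim (A : Type u) [CommRing A]
    (M : Type u) [AddCommGroup M] [Module A M] : Prop :=
  ∃ R : FinRes A M, ∀ n, Module.Projective A (R.G n)

/-- `S` is an `n`-th syzygy of `M`: for `n = 0`, `S ≅ M`; for `n ≥ 1`, `S` is isomorphic to
the image of the `n`-th differential in a minimal free resolution of `M`. -/
def IsSyzygy (A : Type u) [CommRing A] [IsLocalRing A]
    (M : Type u) [AddCommGroup M] [Module A M]
    (S : Type u) [AddCommGroup S] [Module A S] : ℕ → Prop
  | 0 => Nonempty (S ≃ₗ[A] M)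
  | (n + 1) => ∃ R : MinFreeRes A M, Nonempty (S ≃ₗ[A] LinearMap.range (R.d n))

/-- `K` is obtained from `M` by a reduction of complexity coming from a cohomology class
of degree `t ≥ 1`, i.e. there is a short exact sequence `0 → M → K → Ω^{t-1}(M) → 0`. -/
def ReducesWithDeg (A : Type u) [CommRing A] [IsLocalRing A]
    (M K : ModuleCat.{u} A) (t : ℕ) : Prop :=
  1 ≤ t ∧ ∃ (S : Type u) (_ : AddCommGroup S) (_ : Module A S),
    IsSyzygy A M S (t - 1) ∧
    ∃ (f : M →ₗ[A] K) (g : K →ₗ[A] S),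
      Function.Injective f ∧ Function.Surjective g ∧ Function.Exact f g

/-- The class of (bundled) modules having reducible complexity: the smallest class
containing all modules of finite projective dimension, and containing every module `M` of
finite positive complexity admitting a short exact sequence
`0 → M → K → Ω^{t-1}(M) → 0` (coming from a degree-`t` self-extension) with
`cx K < cx M` and `K` of reducible complexity. -/
inductive HasRedCxCat (A : Type u) [CommRing A] [IsLocalRing A] : ModuleCat.{u} A → Prop
  | of_finite_pd (M : ModuleCat.{u} A) : HasFiniteProjDim A M → HasRedCxCat A M
  | of_step (M K : ModuleCat.{u} A) (t : ℕ) :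
      complexity A M ≠ 0 → complexity A M ≠ ⊤ →
      ReducesWithDeg A M K t →
      complexity A K < complexity A M →
      HasRedCxCat A K → HasRedCxCat A M

/-- A module has reducible complexity. -/
def HasReducibleComplexity (A : Type u) [CommRing A] [IsLocalRing A]
    (M : Type u) [AddCommGroup M] [Module A M] : Prop :=
  HasRedCxCat A (ModuleCat.of A M)

/-- A sequence of short exact sequences `0 → K_{i-1} → K_i → Ω^{d_i - 1}(K_{i-1}) → 0`
with strictly decreasing complexities, ending in a module of complexity zero, i.e. a
sequence reducing the complexity of `Ks 0`. -/
def IsReducingSeq (A : Type u) [CommRing A] [IsLocalRing A] (t : ℕ)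
    (Ks : Fin (t + 1) → ModuleCat.{u} A) (degs : Fin t → ℕ) : Prop :=
  (∀ i : Fin t, ReducesWithDeg A (Ks i.castSucc) (Ks i.succ) (degs i)) ∧
  (∀ i : Fin t, complexity A (Ks i.succ) < complexity A (Ks i.castSucc)) ∧
  complexity A (Ks (Fin.last t)) = 0

open Classical in
/-- The upper reducing degree of `M`: `⊤` if `M` has finite projective dimension, and
otherwise the supremum, over all sequences reducing the complexity of `M`, of the minimum
of the degrees of the cohomology classes involved. -/
def upperReducingDegree (A : Type u) [CommRing A] [IsLocalRing A]
    (M : Type u) [AddCommGroup M] [Module A M] : ℕ∞ :=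
  if HasFiniteProjDim A M then ⊤
  else sSup {r : ℕ∞ | ∃ (t : ℕ) (Ks : Fin (t + 1) → ModuleCat.{u} A) (degs : Fin t → ℕ),
    Ks 0 = ModuleCat.of A M ∧ IsReducingSeq A t Ks degs ∧
    r = ⨅ i : Fin t, (degs i : ℕ∞)}

/-- The `n`-th Tor module of two modules. -/
def torModule (A : Type u) [CommRing A] (M N : Type u)
    [AddCommGroup M] [Module A M] [AddCommGroup N] [Module A N] (n : ℕ) : ModuleCat.{u} A :=
  ((Tor (ModuleCat.{u} A) n).obj (ModuleCat.of A M)).obj (ModuleCat.of A N)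

/-- Two modules are Tor-independent if `Tor_n(M, N) = 0` for all `n > 0`. -/
def TorIndep (A : Type u) [CommRing A] (M N : Type u)
    [AddCommGroup M] [Module A M] [AddCommGroup N] [Module A N] : Prop :=
  ∀ n : ℕ, 0 < n → Subsingleton (torModule A M N n)

/-- The `n`-th Ext module of two modules. -/
def extModule (A : Type u) [CommRing A] (M N : Type u)
    [AddCommGroup M] [Module A M] [AddCommGroup N] [Module A N] (n : ℕ) : ModuleCat.{u} A :=
  ((Ext A (ModuleCat.{u} A) n).obj (Opposite.op (ModuleCat.of A M))).obj (ModuleCat.of A N)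

/-- A module `G` has Gorenstein dimension zero if it is reflexive and
`Ext^n(G, A) = 0 = Ext^n(Hom(G, A), A)` for all `n > 0`. -/
def GDimZero (A : Type u) [CommRing A] (G : Type u) [AddCommGroup G] [Module A G] : Prop :=
  Module.IsReflexive A G ∧
  ∀ n : ℕ, 0 < n →
    Subsingleton (extModule A G A n) ∧ Subsingleton (extModule A (Module.Dual A G) A n)

/-- A module has finite Gorenstein dimension if it admits a finite resolution by modules
of Gorenstein dimension zero. -/
def HasFiniteGDim (A : Type u) [CommRing A]
    (M : Type u) [AddCommGroup M] [Module A M] : Prop :=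
  ∃ R : FinRes A M, ∀ n, GDimZero A (R.G n)


/-- The Krull dimension of a ring, viewed in `WithBot ℕ∞`. -/
def ringKrullDimE (A : Type u) [CommRing A] : WithBot ℕ∞ := ringKrullDim A

/-- A local ring is Cohen-Macaulay if its depth equals its Krull dimension. -/
def IsCMLocalRing (A : Type u) [CommRing A] [IsLocalRing A] : Prop :=
  (moduleDepth A A : WithBot ℕ∞) = ringKrullDimE A

/-- A module over a local ring is maximal Cohen-Macaulay if its depth equals the Krull
dimension of the ring. -/
def IsMaxCM (A : Type u) [CommRing A] [IsLocalRing A]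
    (M : Type u) [AddCommGroup M] [Module A M] : Prop :=
  (moduleDepth A M : WithBot ℕ∞) = ringKrullDimE A

/-- A local ring is Gorenstein if and only if every finitely generated module over it has
finite Gorenstein dimension. -/
def IsGorensteinLocalRing (A : Type u) [CommRing A] [IsLocalRing A] : Prop :=
  ∀ M : ModuleCat.{u} A, Module.Finite A M → HasFiniteGDim A M

/-- A module `M` over a local ring `A` has finite CI-dimension if there is a diagram of
local ring homomorphisms `A → R ← Q` with `A → R` flat and `Q → R` surjective with kernel
generated by a regular sequence, such that `R ⊗_A M` has finite projective dimension
over `Q`. -/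
def HasFiniteCIDimMod (A : Type u) [CommRing A] [IsLocalRing A]
    (M : Type u) [AddCommGroup M] [Module A M] : Prop :=
  ∃ (R Q : Type u) (_ : CommRing R) (_ : CommRing Q) (_ : IsLocalRing R) (_ : IsLocalRing Q)
    (f : A →+* R) (g : Q →+* R),
    IsLocalHom f ∧ IsLocalHom g ∧ Function.Surjective g ∧
    (∃ rs : List Q, RingTheory.Sequence.IsRegular Q rs ∧
      RingHom.ker g = Ideal.span {x | x ∈ rs}) ∧
    (letI : Algebra A R := f.toAlgebra
     Module.Flat A R ∧
     (letI : Module Q (TensorProduct A R M) := Module.compHom _ g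
      HasFiniteProjDim Q (TensorProduct A R M)))



section ExtResidueField

open Abelian TensorProduct

variable {A : Type u} [CommRing A] [IsLocalRing A]
variable {X Y Z N : Type u} [AddCommGroup X] [Module A X] [AddCommGroup Y] [Module A Y]
  [AddCommGroup Z] [Module A Z] [AddCommGroup N] [Module A N]

omit [IsLocalRing A] in
lemma ofHom_smul (a : A) (φ : X →ₗ[A] Y) :
    ModuleCat.ofHom (a • φ) = a • ModuleCat.ofHom φ := rfl

/-- The linear maps `X → Y` inducing the zero map on `Ext^n(k, -)`, where `k` is the residue
field of `A`. -/
def extKernel (X Y : Type u) [AddCommGroup X] [Module A X] [AddCommGroup Y] [Module A Y]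
    (n : ℕ) : Submodule A (X →ₗ[A] Y) where
  carrier := {φ | ∀ e : Ext (ModuleCat.of A (ResidueField A)) (ModuleCat.of A X) n,
    e.comp (Ext.mk₀ (ModuleCat.ofHom φ)) (add_zero n) = 0}
  add_mem' {φ ψ} hφ hψ e := by
    simp only [Set.mem_ofPred_eq] at hφ hψ
    rw [ModuleCat.ofHom_add, Ext.mk₀_add, Ext.comp_add, hφ, hψ, add_zero]
  zero_mem' e := by
    rw [ModuleCat.ofHom_zero, Ext.mk₀_zero, Ext.comp_zero]
  smul_mem' a φ hφ e := by
    simp only [Set.mem_ofPred_eq] at hφ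
    rw [ofHom_smul, Ext.mk₀_smul, Ext.comp_smul, hφ, smul_zero]

lemma mem_extKernel {n : ℕ} {φ : X →ₗ[A] Y} : φ ∈ extKernel X Y n ↔
    ∀ e : Ext (ModuleCat.of A (ResidueField A)) (ModuleCat.of A X) n,
      e.comp (Ext.mk₀ (ModuleCat.ofHom φ)) (add_zero n) = 0 := Iff.rfl

lemma comp_mem_extKernel_left {n : ℕ} {φ : X →ₗ[A] Y} (h : φ ∈ extKernel X Y n)
    (ψ : Y →ₗ[A] Z) : ψ ∘ₗ φ ∈ extKernel X Z n := fun e => by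
  rw [ModuleCat.ofHom_comp, ← Ext.mk₀_comp_mk₀, ← Ext.comp_assoc_of_third_deg_zero,
    mem_extKernel.1 h, Ext.zero_comp]

lemma comp_mem_extKernel_right {n : ℕ} {ψ : Y →ₗ[A] Z} (h : ψ ∈ extKernel Y Z n)
    (φ : X →ₗ[A] Y) : ψ ∘ₗ φ ∈ extKernel X Z n := fun e => by
  rw [ModuleCat.ofHom_comp, ← Ext.mk₀_comp_mk₀, ← Ext.comp_assoc_of_third_deg_zero,
    mem_extKernel.1 h]

lemma smul_mem_extKernel {a : A} (ha : a ∈ maximalIdeal A) (n : ℕ) (φ : X →ₗ[A] Y) :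
    a • φ ∈ extKernel X Y n := fun e => by
  have h0 : a • 𝟙 (ModuleCat.of A (ResidueField A)) = 0 := by
    ext x
    obtain ⟨x, rfl⟩ := residue_surjective x
    change a • residue A x = 0
    rw [Algebra.smul_def, ResidueField.algebraMap_eq, (residue_eq_zero_iff a).2 ha, zero_mul]
  have : a • e = 0 := by
    rw [← Ext.mk₀_id_comp e, ← Ext.smul_comp, ← Ext.mk₀_smul, h0, Ext.mk₀_zero, Ext.zero_comp]
  rw [ofHom_smul, Ext.mk₀_smul, Ext.comp_smul, ← Ext.smul_comp, this, Ext.zero_comp]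

/-- `Ext^n(k, X) = 0`, where `k` is the residue field of `A`. -/
def ExtVanishes (A : Type u) [CommRing A] [IsLocalRing A]
    (X : Type u) [AddCommGroup X] [Module A X] (n : ℕ) : Prop :=
  (LinearMap.id : X →ₗ[A] X) ∈ extKernel X X n

lemma extVanishes_iff {n : ℕ} : ExtVanishes A X n ↔
    ∀ e : Ext (ModuleCat.of A (ResidueField A)) (ModuleCat.of A X) n, e = 0 := by
  refine forall_congr' fun e => ?_
  rw [ModuleCat.ofHom_id, Ext.comp_mk₀_id]

lemma ExtVanishes.mem_extKernel_right {n : ℕ} (h : ExtVanishes A Y n) (φ : X →ₗ[A] Y) :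
    φ ∈ extKernel X Y n :=
  comp_mem_extKernel_right h φ

lemma ExtVanishes.of_leftInverse {n : ℕ} (h : ExtVanishes A Y n) (s : X →ₗ[A] Y)
    (r : Y →ₗ[A] X) (hrs : r ∘ₗ s = LinearMap.id) : ExtVanishes A X n := by
  rw [ExtVanishes, ← hrs]
  exact comp_mem_extKernel_left (h.mem_extKernel_right s) r

lemma ExtVanishes.of_equiv {n : ℕ} (h : ExtVanishes A X n) (e : X ≃ₗ[A] Y) :
    ExtVanishes A Y n :=
  h.of_leftInverse e.symm.toLinearMap e.toLinearMap (by ext; simp)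

lemma extVanishes_zero_iff :
    ExtVanishes A X 0 ↔ Subsingleton (ResidueField A →ₗ[A] X) := by
  rw [extVanishes_iff]
  constructor
  · intro h
    refine subsingleton_of_forall_eq 0 fun f => ?_
    have h1 := h (Ext.mk₀ (ModuleCat.ofHom f))
    rw [Ext.mk₀_eq_zero_iff] at h1
    simpa using congrArg ModuleCat.Hom.hom h1
  · intro h e
    obtain ⟨f, rfl⟩ := Ext.addEquiv₀.symm.surjective e
    have : f = 0 := ModuleCat.hom_ext (Subsingleton.elim _ _)
    rw [this, map_zero]

section ShortExact

variable {f : X →ₗ[A] Y} {g : Y →ₗ[A] Z}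

/-- The short complex of module categories attached to an exact pair of linear maps. -/
def exactPairComplex (hfg : Function.Exact f g) : ShortComplex (ModuleCat.{u} A) :=
  ModuleCat.shortComplexOfCompEqZero f g hfg.linearMap_comp_eq_zero

omit [IsLocalRing A] in
lemma exactPairComplex_shortExact (hf : Function.Injective f) (hg : Function.Surjective g)
    (hfg : Function.Exact f g) : (exactPairComplex hfg).ShortExact where
  exact := ModuleCat.shortComplex_exact _ hfg
  mono_f := (ModuleCat.mono_iff_injective _).2 hf
  epi_g := (ModuleCat.epi_iff_surjective _).2 hg

lemma ExtVanishes.middle {n : ℕ} (hf : Function.Injective f) (hg : Function.Surjective g)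
    (hfg : Function.Exact f g) (h₁ : ExtVanishes A X n) (h₃ : ExtVanishes A Z n) :
    ExtVanishes A Y n := by
  rw [extVanishes_iff] at h₁ h₃ ⊢
  intro e
  obtain ⟨e', rfl⟩ := Ext.covariant_sequence_exact₂ _ (exactPairComplex_shortExact hf hg hfg) e
    (h₃ _)
  rw [show e' = 0 from h₁ e', Ext.zero_comp]
  rfl

lemma ExtVanishes.right {n : ℕ} (hf : Function.Injective f) (hg : Function.Surjective g)
    (hfg : Function.Exact f g) (h₂ : ExtVanishes A Y n) (h₁ : ExtVanishes A X (n + 1)) :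
    ExtVanishes A Z n := by
  rw [extVanishes_iff] at h₁ h₂ ⊢
  intro e
  obtain ⟨e', rfl⟩ := Ext.covariant_sequence_exact₃ _ (exactPairComplex_shortExact hf hg hfg) e
    rfl (h₁ _)
  rw [show e' = 0 from h₂ e', Ext.zero_comp]
  rfl

lemma ExtVanishes.left_succ {n : ℕ} (hf : Function.Injective f) (hg : Function.Surjective g)
    (hfg : Function.Exact f g) (h₃ : ExtVanishes A Z n) (h : f ∈ extKernel X Y (n + 1)) :
    ExtVanishes A X (n + 1) := by
  rw [extVanishes_iff] at h₃ ⊢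
  intro e
  obtain ⟨e', rfl⟩ := Ext.covariant_sequence_exact₁ _ (exactPairComplex_shortExact hf hg hfg) e
    (h e) rfl
  rw [show e' = 0 from h₃ e', Ext.zero_comp]
  rfl

lemma ExtVanishes.left_zero (hf : Function.Injective f) (h : f ∈ extKernel X Y 0) :
    ExtVanishes A X 0 := by
  rw [extVanishes_iff]
  intro e
  have : Mono (ModuleCat.ofHom f) := (ModuleCat.mono_iff_injective _).2 hf
  refine Ext.postcomp_mk₀_injective_of_mono _ (ModuleCat.ofHom f) ?_
  rw [map_zero]
  exact h e

end ShortExact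

section Free

variable {F G : Type u} [AddCommGroup F] [Module A F] [AddCommGroup G] [Module A G]
  [Module.Free A F] [Module.Finite A F]

omit [IsLocalRing A] in
lemma eq_sum_toSpanSingleton_comp_coord (φ : F →ₗ[A] G) :
    φ = ∑ i, LinearMap.toSpanSingleton A G (φ (Module.Free.chooseBasis A F i)) ∘ₗ
      (Module.Free.chooseBasis A F).coord i := by
  refine (Module.Free.chooseBasis A F).ext fun j => ?_
  simp [Finsupp.single_apply]

lemma ExtVanishes.free_tensor {n : ℕ} (h : ExtVanishes A N n) : ExtVanishes A (F ⊗[A] N) n := by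
  rw [ExtVanishes, ← LinearMap.rTensor_id,
    eq_sum_toSpanSingleton_comp_coord (LinearMap.id : F →ₗ[A] F), ← LinearMap.coe_rTensorHom,
    map_sum]
  refine Submodule.sum_mem _ fun i _ => ?_
  rw [LinearMap.coe_rTensorHom, LinearMap.rTensor_comp]
  exact comp_mem_extKernel_left
    ((h.of_equiv (TensorProduct.lid A N).symm).mem_extKernel_right _) _

lemma ExtVanishes.free {n : ℕ} (h : ExtVanishes A A n) : ExtVanishes A F n :=
  (h.free_tensor (F := F)).of_equiv (TensorProduct.rid A F)

omit [Module.Finite A F] in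
lemma ExtVanishes.of_free_tensor [Nontrivial F] {n : ℕ} (h : ExtVanishes A (F ⊗[A] N) n) :
    ExtVanishes A N n := by
  let b := Module.Free.chooseBasis A F
  obtain ⟨i⟩ := b.index_nonempty
  refine h.of_leftInverse (TensorProduct.mk A F N (b i))
    ((TensorProduct.lid A N).toLinearMap ∘ₗ (b.coord i).rTensor N) ?_
  ext x
  simp

lemma rTensor_mem_extKernel_of_minimal (φ : F →ₗ[A] G)
    (h : ∀ x, φ x ∈ maximalIdeal A • (⊤ : Submodule A G)) (n : ℕ) :
    φ.rTensor N ∈ extKernel (F ⊗[A] N) (G ⊗[A] N) n := by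
  rw [eq_sum_toSpanSingleton_comp_coord φ, ← LinearMap.coe_rTensorHom, map_sum]
  refine Submodule.sum_mem _ fun i _ => ?_
  rw [LinearMap.coe_rTensorHom, LinearMap.rTensor_comp]
  refine comp_mem_extKernel_right ?_ _
  generalize φ _ = v, h (Module.Free.chooseBasis A F i) = hv
  induction hv using Submodule.smul_induction_on' with
  | smul a ha x _ =>
    rw [show LinearMap.toSpanSingleton A G (a • x) = a • LinearMap.toSpanSingleton A G x by
      ext; simp, LinearMap.rTensor_smul]
    exact smul_mem_extKernel ha n _
  | add x _ y _ hx hy =>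
    rw [LinearMap.toSpanSingleton_add, LinearMap.rTensor_add]
    exact Submodule.add_mem _ hx hy

end Free

section Depth

variable (A) in
lemma annihilator_residueField : Module.annihilator A (ResidueField A) = maximalIdeal A :=
  Ideal.annihilator_quotient

lemma extVanishes_zero_of_isSMulRegular {x : A} (hx : x ∈ maximalIdeal A)
    (h : IsSMulRegular X x) : ExtVanishes A X 0 :=
  extVanishes_zero_iff.2 <| IsSMulRegular.linearMap_subsingleton_of_mem_annihilator h
    ((annihilator_residueField A).symm ▸ hx)

lemma exists_isSMulRegular_of_extVanishes_zero [IsNoetherianRing A] [Module.Finite A X]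
    (h : ExtVanishes A X 0) : ∃ x ∈ maximalIdeal A, IsSMulRegular X x := by
  rw [extVanishes_zero_iff, IsSMulRegular.subsingleton_linearMap_iff,
    annihilator_residueField] at h
  exact h

open Pointwise in
lemma ExtVanishes.succ_of_quotSMulTop {x : A} (hx : x ∈ maximalIdeal A)
    (h : IsSMulRegular X x) {n : ℕ} (hn : ExtVanishes A (QuotSMulTop x X) n) :
    ExtVanishes A X (n + 1) :=
  ExtVanishes.left_succ (f := LinearMap.lsmul A X x) h (Submodule.mkQ_surjective _)
    (LinearMap.exact_lsmul_mkQ_smul_top X x) hn (smul_mem_extKernel hx _ LinearMap.id)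

lemma ExtVanishes.quotSMulTop {x : A} (h : IsSMulRegular X x) {n : ℕ}
    (hn : ExtVanishes A X n) (hn' : ExtVanishes A X (n + 1)) :
    ExtVanishes A (QuotSMulTop x X) n :=
  ExtVanishes.right (f := LinearMap.lsmul A X x) h (Submodule.mkQ_surjective _)
    (LinearMap.exact_lsmul_mkQ_smul_top X x) hn hn'

lemma extVanishes_of_isWeaklyRegular (rs : List A) (hrs : ∀ x ∈ rs, x ∈ maximalIdeal A)
    (h : RingTheory.Sequence.IsWeaklyRegular X rs) {i : ℕ} (hi : i < rs.length) :
    ExtVanishes A X i := by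
  induction rs generalizing X i with
  | nil => simp at hi
  | cons x rs ih =>
    rw [RingTheory.Sequence.isWeaklyRegular_cons_iff] at h
    have hx := hrs x (by simp)
    cases i with
    | zero => exact extVanishes_zero_of_isSMulRegular hx h.1
    | succ i =>
      exact (ih (fun y hy => hrs y (by simp [hy])) h.2 (by simpa using hi)).succ_of_quotSMulTop
        hx h.1

lemma extVanishes_of_lt_moduleDepth {i : ℕ} (h : (i : ℕ∞) < moduleDepth A X) :
    ExtVanishes A X i := by
  obtain ⟨_, ⟨rs, rfl, hrs, hreg⟩, hi⟩ := lt_sSup_iff.1 h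
  exact extVanishes_of_isWeaklyRegular rs hrs hreg.toIsWeaklyRegular (by exact_mod_cast hi)

lemma moduleDepth_pos_iff [IsNoetherianRing A] [Module.Finite A X] [Nontrivial X] :
    0 < moduleDepth A X ↔ ExtVanishes A X 0 := by
  refine ⟨fun h => extVanishes_of_lt_moduleDepth (by exact_mod_cast h), fun h => ?_⟩
  obtain ⟨x, hx, hreg⟩ := exists_isSMulRegular_of_extVanishes_zero h
  refine lt_sSup_iff.2 ⟨1, ⟨[x], by simp, by simpa using hx, ?_⟩, by simp⟩
  rw [IsLocalRing.isRegular_iff_isWeaklyRegular_of_subset_maximalIdeal (by simpa using hx)]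
  simpa using hreg

lemma exists_not_extVanishes_le_supportDim [IsNoetherianRing A] [Module.Finite A X]
    [Nontrivial X] (d : ℕ) (hd : Module.supportDim A X ≤ d) :
    ∃ n ≤ d, ¬ ExtVanishes A X n := by
  induction d generalizing X with
  | zero =>
    refine ⟨0, le_rfl, fun h0 => ?_⟩
    obtain ⟨x, hx, hreg⟩ := exists_isSMulRegular_of_extVanishes_zero h0
    have : Nontrivial (QuotSMulTop x X) := nontrivial_quotSMulTop_of_mem_maximalIdeal X hx
    rw [← Module.supportDim_quotSMulTop_succ_eq_supportDim hreg hx, Nat.cast_zero,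
      ENat.WithBot.add_one_le_zero_iff] at hd
    exact Module.supportDim_ne_bot_of_nontrivial A _ hd
  | succ d ih =>
    by_cases h0 : ExtVanishes A X 0
    · obtain ⟨x, hx, hreg⟩ := exists_isSMulRegular_of_extVanishes_zero h0
      have : Nontrivial (QuotSMulTop x X) := nontrivial_quotSMulTop_of_mem_maximalIdeal X hx
      rw [← Module.supportDim_quotSMulTop_succ_eq_supportDim hreg hx, Nat.cast_succ,
        ENat.WithBot.add_le_add_one_right_iff] at hd
      obtain ⟨n, hn, hv⟩ := ih hd
      by_cases hn' : ExtVanishes A X n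
      · exact ⟨n + 1, by lia, fun h => hv (hn'.quotSMulTop hreg h)⟩
      · exact ⟨n, by lia, hn'⟩
    · exact ⟨0, by lia, h0⟩

lemma IsCMLocalRing.extVanishes (hCM : IsCMLocalRing A) {d : ℕ} (hd : ringKrullDim A = d)
    {i : ℕ} (hi : i < d) : ExtVanishes A A i := by
  refine extVanishes_of_lt_moduleDepth ?_
  have h : (moduleDepth A A : WithBot ℕ∞) = ((d : ℕ∞) : WithBot ℕ∞) := hCM.trans hd
  rw [WithBot.coe_injective h]
  exact_mod_cast hi

end Depth

end ExtResidueField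

section Tor

open TensorProduct

/-- A flat resolution of an `A`-module. -/
structure FlatRes (A : Type u) [CommRing A] (N : Type u) [AddCommGroup N] [Module A N] :
    Type (u + 1) where
  P : ℕ → ModuleCat.{u} A
  flat : ∀ n, Module.Flat A (P n)
  d : ∀ n, P (n + 1) →ₗ[A] P n
  aug : P 0 →ₗ[A] N
  aug_surj : Function.Surjective aug
  exact_aug : Function.Exact (d 0) aug
  exact_d : ∀ n, Function.Exact (d (n + 1)) (d n)

variable {A : Type u} [CommRing A]
variable {X Y Z N : Type u} [AddCommGroup X] [Module A X] [AddCommGroup Y] [Module A Y]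
  [AddCommGroup Z] [Module A Z] [AddCommGroup N] [Module A N]

namespace FlatRes

/-- Tensoring the resolution with `X` gives a complex which is exact in positive degrees. -/
def Acyclic (R : FlatRes A N) (X : Type u) [AddCommGroup X] [Module A X] : Prop :=
  ∀ n, Function.Exact ((R.d (n + 1)).lTensor X) ((R.d n).lTensor X)

/-- The flat resolution underlying a projective resolution. -/
def ofProjectiveResolution (P : ProjectiveResolution (ModuleCat.of A N)) : FlatRes A N where
  P := P.complex.X
  flat n := by
    have := P.projective n
    have : Module.Projective A (P.complex.X n) := (IsProjective.iff_projective _).2 this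
    infer_instance
  d n := (P.complex.d (n + 1) n).hom
  aug := (P.π.f 0).hom
  aug_surj := (ModuleCat.epi_iff_surjective _).1 inferInstance
  exact_aug := (ShortComplex.ShortExact.moduleCat_exact_iff_function_exact _).1 P.exact₀
  exact_d n := (ShortComplex.ShortExact.moduleCat_exact_iff_function_exact _).1 (P.exact_succ n)

lemma acyclic_ofProjectiveResolution (P : ProjectiveResolution (ModuleCat.of A N))
    (h : TorIndep A X N) : (ofProjectiveResolution P).Acyclic X := fun n => by
  have h1 : Limits.IsZero (torModule A X N (n + 1)) :=
    (ModuleCat.isZero_iff_subsingleton).2 (h (n + 1) n.succ_pos)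
  have h2 := h1.of_iso (P.isoLeftDerivedObj
    ((MonoidalCategory.tensoringLeft (ModuleCat A)).obj (ModuleCat.of A X)) (n + 1)).symm
  rw [HomologicalComplex.homologyFunctor_obj, ← HomologicalComplex.exactAt_iff_isZero_homology,
    HomologicalComplex.exactAt_iff' _ (n + 2) (n + 1) n (by simp) (by simp)] at h2
  exact (ShortComplex.ShortExact.moduleCat_exact_iff_function_exact _).1 h2

lemma acyclic_of_flat (R : FlatRes A N) [Module.Flat A X] : R.Acyclic X := fun n =>
  Module.Flat.lTensor_exact X (R.exact_d n)

lemma Acyclic.of_equiv {R : FlatRes A N} (h : R.Acyclic X) (e : X ≃ₗ[A] Y) : R.Acyclic Y := by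
  intro n
  refine (Function.Exact.iff_of_ladder_linearEquiv (e₁ := e.rTensor _) (e₂ := e.rTensor _)
    (e₃ := e.rTensor _) ?_ ?_).2 (h n) <;> ext <;> simp

variable {f : X →ₗ[A] Y} {g : Y →ₗ[A] Z} {R : FlatRes A N}

lemma rTensor_lTensor_apply {P Q : Type*} [AddCommGroup P] [Module A P] [AddCommGroup Q]
    [Module A Q] (f : X →ₗ[A] Y) (d : P →ₗ[A] Q) (t : X ⊗[A] P) :
    f.rTensor Q (d.lTensor X t) = d.lTensor Y (f.rTensor P t) := by
  rw [← LinearMap.comp_apply, ← LinearMap.comp_apply, LinearMap.rTensor_comp_lTensor,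
    LinearMap.lTensor_comp_rTensor]

lemma lTensor_d_d (R : FlatRes A N) (X : Type u) [AddCommGroup X] [Module A X] (n : ℕ)
    (t : X ⊗[A] R.P (n + 2)) : (R.d n).lTensor X ((R.d (n + 1)).lTensor X t) = 0 := by
  rw [← LinearMap.comp_apply, ← LinearMap.lTensor_comp, (R.exact_d n).linearMap_comp_eq_zero,
    LinearMap.lTensor_zero, LinearMap.zero_apply]

lemma Acyclic.middle (hf : Function.Injective f) (hg : Function.Surjective g)
    (hfg : Function.Exact f g) (hX : R.Acyclic X) (hZ : R.Acyclic Z) : R.Acyclic Y := by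
  intro n y
  refine ⟨fun hy => ?_, ?_⟩
  · obtain ⟨z₂, hz₂⟩ := (hZ n (g.rTensor _ y)).1 (by
      rw [← rTensor_lTensor_apply, hy, map_zero])
    obtain ⟨y₂, rfl⟩ := LinearMap.rTensor_surjective _ hg z₂
    obtain ⟨x, hx⟩ := (rTensor_exact (R.P (n + 1)) hfg hg
      (y - (R.d (n + 1)).lTensor Y y₂)).1 (by
        rw [map_sub, rTensor_lTensor_apply, hz₂, sub_self])
    have := R.flat n
    obtain ⟨x₂, rfl⟩ := (hX n x).1 (by
      apply Module.Flat.rTensor_preserves_injective_linearMap (M := R.P n) f hf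
      rw [rTensor_lTensor_apply, hx, map_sub, hy, lTensor_d_d, sub_zero, map_zero])
    refine ⟨y₂ + f.rTensor _ x₂, ?_⟩
    rw [map_add, ← rTensor_lTensor_apply, hx, add_sub_cancel]
  · rintro ⟨y₂, rfl⟩
    exact lTensor_d_d R Y n y₂

lemma Acyclic.left (hf : Function.Injective f) (hg : Function.Surjective g)
    (hfg : Function.Exact f g) (hY : R.Acyclic Y) (hZ : R.Acyclic Z) : R.Acyclic X := by
  intro n x
  refine ⟨fun hx => ?_, ?_⟩
  · obtain ⟨y₂, hy₂⟩ := (hY n (f.rTensor _ x)).1 (by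
      rw [← rTensor_lTensor_apply, hx, map_zero])
    obtain ⟨z₃, hz₃⟩ := (hZ (n + 1) (g.rTensor _ y₂)).1 (by
      rw [← rTensor_lTensor_apply, hy₂, ← LinearMap.comp_apply, ← LinearMap.rTensor_comp,
        hfg.linearMap_comp_eq_zero, LinearMap.rTensor_zero, LinearMap.zero_apply])
    obtain ⟨y₃, rfl⟩ := LinearMap.rTensor_surjective _ hg z₃
    obtain ⟨x₂, hx₂⟩ := (rTensor_exact (R.P (n + 2)) hfg hg
      (y₂ - (R.d (n + 2)).lTensor Y y₃)).1 (by
        rw [map_sub, rTensor_lTensor_apply, hz₃, sub_self])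
    have := R.flat (n + 1)
    refine ⟨x₂, Module.Flat.rTensor_preserves_injective_linearMap (M := R.P (n + 1)) f hf ?_⟩
    rw [rTensor_lTensor_apply, hx₂, map_sub, hy₂, lTensor_d_d, sub_zero]
  · rintro ⟨x₂, rfl⟩
    exact lTensor_d_d R X n x₂

lemma Acyclic.rTensor_injective (hf : Function.Injective f) (hg : Function.Surjective g)
    (hfg : Function.Exact f g) (hZ : R.Acyclic Z) : Function.Injective (f.rTensor N) := by
  rw [injective_iff_map_eq_zero]
  intro t ht
  obtain ⟨x, rfl⟩ := LinearMap.lTensor_surjective X R.aug_surj t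
  obtain ⟨y₁, hy₁⟩ := (lTensor_exact Y R.exact_aug R.aug_surj (f.rTensor _ x)).1 (by
    rw [← rTensor_lTensor_apply, ht])
  obtain ⟨z₂, hz₂⟩ := (hZ 0 (g.rTensor _ y₁)).1 (by
    rw [← rTensor_lTensor_apply, hy₁, ← LinearMap.comp_apply, ← LinearMap.rTensor_comp,
      hfg.linearMap_comp_eq_zero, LinearMap.rTensor_zero, LinearMap.zero_apply])
  obtain ⟨y₂, rfl⟩ := LinearMap.rTensor_surjective _ hg z₂
  obtain ⟨x₁, hx₁⟩ := (rTensor_exact (R.P 1) hfg hg (y₁ - (R.d 1).lTensor Y y₂)).1 (by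
    rw [map_sub, rTensor_lTensor_apply, hz₂, sub_self])
  have := R.flat 0
  rw [(lTensor_exact X R.exact_aug R.aug_surj x).2]
  refine ⟨x₁, Module.Flat.rTensor_preserves_injective_linearMap (M := R.P 0) f hf ?_⟩
  rw [rTensor_lTensor_apply, hx₁, map_sub, hy₁, lTensor_d_d, sub_zero]

end FlatRes

end Tor

section MinimalCover

open TensorProduct

variable {A : Type u} [CommRing A] [IsLocalRing A]
variable (X Y : Type u) [AddCommGroup X] [Module A X] [Module.Finite A X]
  [AddCommGroup Y] [Module A Y] [Module.Finite A Y]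

variable (A) in
/-- A minimal free cover of a module, together with its kernel. -/
lemma exists_minimal_cover [IsNoetherianRing A] :
    ∃ (ι : Type u) (_ : Finite ι) (K : ModuleCat.{u} A) (_ : Module.Finite A K)
      (f : K →ₗ[A] ι →₀ A) (π : (ι →₀ A) →ₗ[A] X),
    Function.Injective f ∧ Function.Surjective π ∧ Function.Exact f π ∧
      ∀ x, f x ∈ maximalIdeal A • (⊤ : Submodule A (ι →₀ A)) := by
  let b := Module.Free.chooseBasis (ResidueField A) (ResidueField A ⊗[A] X)
  obtain ⟨v, hv⟩ := (TensorProduct.mk_surjective A X (ResidueField A)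
    residue_surjective).comp_left b
  replace hv : ∀ i, (1 : ResidueField A) ⊗ₜ[A] v i = b i := congr_fun hv
  have := Module.Finite.finite_basis b
  refine ⟨_, this, .of A (LinearMap.ker (Finsupp.linearCombination A v)),
    inferInstanceAs (Module.Finite A (LinearMap.ker _)), Submodule.subtype _,
    Finsupp.linearCombination A v, Submodule.subtype_injective _, ?_,
    LinearMap.exact_subtype_ker_map _, fun ⟨x, hx⟩ => ?_⟩
  · rw [← LinearMap.range_eq_top, Finsupp.range_linearCombination]
    exact span_eq_top_of_tmul_eq_basis v b hv
  · have h0 : Finsupp.linearCombination (ResidueField A) b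
        (x.mapRange (residue A) (map_zero _)) = 0 := by
      have h1 := congr_arg (TensorProduct.mk A (ResidueField A) X 1) (LinearMap.mem_ker.1 hx)
      rw [map_zero, Finsupp.linearCombination_apply, Finsupp.sum, map_sum] at h1
      rw [Finsupp.linearCombination_apply, Finsupp.sum_mapRange_index (by simp), ← h1]
      refine Finset.sum_congr rfl fun i _ => ?_
      rw [map_smul, TensorProduct.mk_apply, hv]
      exact algebraMap_smul (ResidueField A) (x i) (b i)
    have h2 := (linearIndependent_iff.1 b.linearIndependent) _ h0
    change x ∈ _
    rw [← Finsupp.sum_single x]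
    refine Submodule.sum_mem _ fun i _ => ?_
    have h3 : x i ∈ maximalIdeal A := by
      rw [← residue_eq_zero_iff]
      simpa using DFunLike.congr_fun h2 i
    have := Submodule.smul_mem_smul h3
      (Submodule.mem_top : Finsupp.single i (1 : A) ∈ (⊤ : Submodule A (_ →₀ A)))
    simpa using this

lemma nontrivial_tensorProduct [Nontrivial X] [Nontrivial Y] : Nontrivial (X ⊗[A] Y) := by
  have key : ∀ (W : Type u) [AddCommGroup W] [Module A W] [Module.Finite A W],
      Nontrivial (ResidueField A ⊗[A] W) ↔ Nontrivial W := fun W _ _ _ => by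
    rw [← not_subsingleton_iff_nontrivial, ← not_subsingleton_iff_nontrivial,
      IsLocalRing.subsingleton_tensorProduct]
  have := (key X).2 ‹_›
  have := (key Y).2 ‹_›
  rw [← key, (AlgebraTensorModule.distribBaseChange A (ResidueField A) X Y).nontrivial_congr]
  exact (Module.FaithfullyFlat.nontrivial_tensorProduct_iff_right _ _).2 ‹_›

end MinimalCover

section ProjectiveDimension

variable {A : Type u} [CommRing A]

lemma exact_subtype_range {X Y Z : Type*} [AddCommGroup X] [Module A X] [AddCommGroup Y]
    [Module A Y] [AddCommGroup Z] [Module A Z] {f : X →ₗ[A] Y} {g : Y →ₗ[A] Z}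
    (h : Function.Exact f g) : Function.Exact (LinearMap.range f).subtype g :=
  fun y => by simpa using h y

lemma exact_subtype_range_rangeRestrict {X Y Z : Type*} [AddCommGroup X] [Module A X]
    [AddCommGroup Y] [Module A Y] [AddCommGroup Z] [Module A Z] {f : X →ₗ[A] Y} {g : Y →ₗ[A] Z}
    (h : Function.Exact f g) :
    Function.Exact (LinearMap.range f).subtype g.rangeRestrict := fun y => by
  rw [← exact_subtype_range h y]
  exact Subtype.ext_iff

lemma HasFiniteProjDim.exists_hasProjectiveDimensionLT
    {M : Type u} [AddCommGroup M] [Module A M] (h : HasFiniteProjDim A M) :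
    ∃ n, HasProjectiveDimensionLT (ModuleCat.of A M) n := by
  obtain ⟨R, hR⟩ := h
  have hproj (n m : ℕ) : HasProjectiveDimensionLT (R.G n) (m + 1) := by
    have : Projective (R.G n) := by
      have := hR n
      exact (IsProjective.iff_projective (R := A) (R.G n)).1 this
    infer_instance
  have hrange : ∀ k n, R.len < n + k →
      HasProjectiveDimensionLT (ModuleCat.of A (LinearMap.range (R.d n))) k := by
    intro k
    induction k with
    | zero =>
      intro n hn
      have := R.bounded (n + 1) (by lia)
      have : Subsingleton (LinearMap.range (R.d n)) := (R.d n).surjective_rangeRestrict.subsingleton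
      exact (ModuleCat.isZero_of_subsingleton _).hasProjectiveDimensionLT_zero
    | succ k ih =>
      intro n hn
      have hfg : Function.Exact (LinearMap.range (R.d (n + 1))).subtype (R.d n).rangeRestrict :=
        exact_subtype_range_rangeRestrict (R.exact_d n)
      exact (exactPairComplex_shortExact (Submodule.subtype_injective _)
        (R.d n).surjective_rangeRestrict hfg).hasProjectiveDimensionLT_X₃ k (ih (n + 1) (by lia))
        (hproj (n + 1) k)
  have hfg : Function.Exact (LinearMap.range (R.d 0)).subtype R.aug :=
    exact_subtype_range R.exact_aug
  exact ⟨_, (exactPairComplex_shortExact (Submodule.subtype_injective _)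
        R.aug_surj hfg).hasProjectiveDimensionLT_X₃ (R.len + 1) (hrange _ 0 (by lia))
        (hproj 0 _)⟩

end ProjectiveDimension

section DepthFormula

open TensorProduct

variable {A : Type u} [CommRing A] [IsLocalRing A]

variable (A) in
lemma exists_ringKrullDim_eq_natCast [IsNoetherianRing A] : ∃ d : ℕ, ringKrullDim A = d := by
  obtain ⟨e, he⟩ := WithBot.ne_bot_iff_exists.1 (ringKrullDim_ne_bot (R := A))
  have he' : e ≠ ⊤ := fun h => ringKrullDim_ne_top (R := A) (by rw [← he, h]; rfl)
  obtain ⟨d, rfl⟩ := ENat.ne_top_iff_exists.1 he'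
  exact ⟨d, he.symm⟩

lemma free_of_hasProjectiveDimensionLT_one {X : Type u} [AddCommGroup X] [Module A X]
    [Module.Finite A X] (hX : HasProjectiveDimensionLT (ModuleCat.of A X) 1) :
    Module.Free A X := by
  have : Module.Projective A X := (IsProjective.iff_projective (R := A) X).2
    (projective_iff_hasProjectiveDimensionLT_one.2 hX)
  exact Module.free_of_flat_of_isLocalRing

lemma ExtVanishes.of_hasProjectiveDimensionLT [IsNoetherianRing A] {p j : ℕ} {X : Type u}
    [AddCommGroup X] [Module A X] [Module.Finite A X]
    (hX : HasProjectiveDimensionLT (ModuleCat.of A X) (p + 1))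
    (h : ∀ i ≤ j + p, ExtVanishes A A i) : ExtVanishes A X j := by
  induction p generalizing j X with
  | zero =>
    have := free_of_hasProjectiveDimensionLT_one hX
    exact (h j le_rfl).free
  | succ p ih =>
    obtain ⟨ι, _, K, _, f, π, hf, hπ, hfπ, -⟩ := exists_minimal_cover A X
    have hker : HasProjectiveDimensionLT K (p + 1) :=
      ((exactPairComplex_shortExact hf hπ hfπ).hasProjectiveDimensionLT_X₃_iff p
        ((IsProjective.iff_projective (R := A) (ι →₀ A)).1 inferInstance)).1 hX
    exact .right hf hπ hfπ (h j (by lia)).free (ih hker fun i hi => h i (by lia))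

/-- The Auslander depth formula `depth (X ⊗ N) = depth N - pd X` for Tor-independent modules,
where `n = depth N` and `p = pd X`. -/
lemma FlatRes.Acyclic.le_and_not_extVanishes_tensor [IsNoetherianRing A] {N : Type u}
    [AddCommGroup N] [Module A N] {R : FlatRes A N} {n p : ℕ}
    (hlt : ∀ i < n, ExtVanishes A N i) (hn : ¬ ExtVanishes A N n) {X : Type u}
    [AddCommGroup X] [Module A X] [Module.Finite A X] (hR : R.Acyclic X)
    (hX : HasProjectiveDimensionLT (ModuleCat.of A X) (p + 1))
    (hX' : ¬ HasProjectiveDimensionLT (ModuleCat.of A X) p) :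
    p ≤ n ∧ ¬ ExtVanishes A (X ⊗[A] N) (n - p) := by
  induction p generalizing X with
  | zero =>
    have := free_of_hasProjectiveDimensionLT_one hX
    have : Nontrivial X := by
      rw [← not_subsingleton_iff_nontrivial]
      exact fun _ => hX' (ModuleCat.isZero_of_subsingleton _).hasProjectiveDimensionLT_zero
    exact ⟨n.zero_le, fun h => hn h.of_free_tensor⟩
  | succ p ih =>
    obtain ⟨ι, _, K, _, f, π, hf, hπ, hfπ, hmin⟩ := exists_minimal_cover A X
    have hS := exactPairComplex_shortExact hf hπ hfπ
    have hproj : Projective (ModuleCat.of A (ι →₀ A)) :=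
      (IsProjective.iff_projective (R := A) (ι →₀ A)).1 inferInstance
    have hker : HasProjectiveDimensionLT K (p + 1) :=
      (hS.hasProjectiveDimensionLT_X₃_iff p hproj).1 hX
    obtain ⟨hpn, hv⟩ := ih (Acyclic.left hf hπ hfπ R.acyclic_of_flat hR) hker
      fun h => hX' (hS.hasProjectiveDimensionLT_X₃ p h
        (hasProjectiveDimensionLT_of_ge (ModuleCat.of A (ι →₀ A)) 1 _ (by lia)))
    have hzero : f.rTensor N ∈ extKernel (K ⊗[A] N) ((ι →₀ A) ⊗[A] N) (n - p) := by
      rcases p with _ | p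
      · have := free_of_hasProjectiveDimensionLT_one (X := K) hker
        exact rTensor_mem_extKernel_of_minimal _ hmin _
      · exact (hlt (n - (p + 1)) (by lia)).free_tensor.mem_extKernel_right _
    have hinj := Acyclic.rTensor_injective hf hπ hfπ hR
    obtain ⟨q, hq⟩ : ∃ q, n - p = q + 1 := by
      refine Nat.exists_eq_succ_of_ne_zero fun h0 => hv ?_
      rw [h0] at hzero ⊢
      exact .left_zero hinj hzero
    rw [hq] at hzero hv
    refine ⟨by lia, fun h => hv ?_⟩
    rw [show n - (p + 1) = q by lia] at h
    exact .left_succ hinj (LinearMap.rTensor_surjective N hπ) (rTensor_exact N hfπ hπ) h hzero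

lemma FlatRes.Acyclic.extVanishes_zero_of_hasProjectiveDimensionLT [IsNoetherianRing A]
    (hCM : IsCMLocalRing A) (hA : ExtVanishes A A 0) {N : Type u}
    [AddCommGroup N] [Module A N] [Module.Finite A N] [Nontrivial N] {R : FlatRes A N} {X : Type u}
    [AddCommGroup X] [Module A X] [Module.Finite A X] (hR : R.Acyclic X)
    (hX : ∃ n, HasProjectiveDimensionLT (ModuleCat.of A X) n) (hX₀ : ¬ ExtVanishes A X 0) :
    ExtVanishes A N 0 ∧ ¬ ExtVanishes A (X ⊗[A] N) 0 := by
  classical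
  obtain ⟨d, hd⟩ : ∃ d : ℕ, ringKrullDim A = d := exists_ringKrullDim_eq_natCast A
  obtain ⟨m, hm, hv⟩ := exists_not_extVanishes_le_supportDim (A := A) (X := N) d
    ((Module.supportDim_le_ringKrullDim A N).trans hd.le)
  have hN : ∃ n, ¬ ExtVanishes A N n := ⟨m, hv⟩
  obtain ⟨p, hp, hp'⟩ : ∃ p, HasProjectiveDimensionLT (ModuleCat.of A X) (p + 1) ∧
      ¬ HasProjectiveDimensionLT (ModuleCat.of A X) p := by
    have h0 : Nat.find hX ≠ 0 := fun h0 => hX₀ <| by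
      have hp := Nat.find_spec hX
      rw [h0] at hp
      have := ModuleCat.isZero_iff_subsingleton.1
        (isZero_of_hasProjectiveDimensionLT_zero (ModuleCat.of A X))
      have : Subsingleton X := this
      rw [extVanishes_zero_iff]
      infer_instance
    obtain ⟨p, hp⟩ := Nat.exists_eq_succ_of_ne_zero h0
    exact ⟨p, by simpa [hp] using Nat.find_spec hX, Nat.find_min hX (by lia)⟩
  obtain ⟨hpn, hT⟩ := hR.le_and_not_extVanishes_tensor (n := Nat.find hN)
    (fun i hi => not_not.1 (Nat.find_min hN hi)) (Nat.find_spec hN) hp hp'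
  have hnp : Nat.find hN ≤ p := by
    by_contra! hlt
    refine hX₀ (.of_hasProjectiveDimensionLT hp fun i hi => hCM.extVanishes hd ?_)
    have := Nat.find_min' hN hv
    lia
  obtain rfl : p = Nat.find hN := le_antisymm hpn hnp
  refine ⟨?_, by simpa using hT⟩
  rcases Nat.eq_zero_or_pos (Nat.find hN) with h0 | h0
  · rw [h0] at hp
    exact absurd (.of_hasProjectiveDimensionLT hp fun i hi => by
      obtain rfl : i = 0 := by lia
      exact hA) hX₀
  · exact not_not.1 (Nat.find_min hN h0)

end DepthFormula

section ReducibleComplexity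

open TensorProduct

variable {A : Type u} [CommRing A] [IsLocalRing A]

namespace MinFreeRes

variable {M N : Type u} [AddCommGroup M] [Module A M] [AddCommGroup N] [Module A N]
  (Q : MinFreeRes A M) {R : FlatRes A N}

lemma acyclic_range_d (hR : R.Acyclic M) (n : ℕ) : R.Acyclic (LinearMap.range (Q.d n)) := by
  induction n with
  | zero =>
    have := Q.free 0
    exact .left (Submodule.subtype_injective _) Q.aug_surj (exact_subtype_range Q.exact_aug)
      R.acyclic_of_flat hR
  | succ n ih =>
    have := Q.free (n + 1)
    exact .left (Submodule.subtype_injective _) (Q.d n).surjective_rangeRestrict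
      (exact_subtype_range_rangeRestrict (Q.exact_d n)) R.acyclic_of_flat ih

lemma extVanishes_range_d_tensor (hR : R.Acyclic M) (hN : ExtVanishes A N 0) (n : ℕ) :
    ExtVanishes A (LinearMap.range (Q.d n) ⊗[A] N) 0 := by
  have := Q.free n
  have := Q.fin n
  have hF : ExtVanishes A (Q.F n ⊗[A] N) 0 := hN.free_tensor
  refine .left_zero (f := (LinearMap.range (Q.d n)).subtype.rTensor N) ?_
    (hF.mem_extKernel_right _)
  cases n with
  | zero =>
    exact FlatRes.Acyclic.rTensor_injective (Submodule.subtype_injective _) Q.aug_surj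
      (exact_subtype_range Q.exact_aug) hR
  | succ n =>
    exact FlatRes.Acyclic.rTensor_injective (Submodule.subtype_injective _)
      (Q.d n).surjective_rangeRestrict
      (exact_subtype_range_rangeRestrict (Q.exact_d n)) (Q.acyclic_range_d hR n)

end MinFreeRes

variable {M N S : Type u} [AddCommGroup M] [Module A M] [AddCommGroup N] [Module A N]
  [AddCommGroup S] [Module A S] {R : FlatRes A N} {n : ℕ}

lemma IsSyzygy.finite [Module.Finite A M] (h : IsSyzygy A M S n) : Module.Finite A S := by
  cases n with
  | zero =>
    obtain ⟨e⟩ := h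
    exact .equiv e.symm
  | succ n =>
    obtain ⟨Q, ⟨e⟩⟩ := h
    have := Q.fin (n + 1)
    exact .equiv e.symm

lemma IsSyzygy.acyclic (h : IsSyzygy A M S n) (hR : R.Acyclic M) : R.Acyclic S := by
  cases n with
  | zero =>
    obtain ⟨e⟩ := h
    exact hR.of_equiv e.symm
  | succ n =>
    obtain ⟨Q, ⟨e⟩⟩ := h
    exact (Q.acyclic_range_d hR n).of_equiv e.symm

lemma IsSyzygy.extVanishes_tensor (h : IsSyzygy A M S n) (hR : R.Acyclic M)
    (hN : ExtVanishes A N 0) (hMN : ExtVanishes A (M ⊗[A] N) 0) :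
    ExtVanishes A (S ⊗[A] N) 0 := by
  cases n with
  | zero =>
    obtain ⟨e⟩ := h
    exact hMN.of_equiv (e.symm.rTensor N)
  | succ n =>
    obtain ⟨Q, ⟨e⟩⟩ := h
    exact (Q.extVanishes_range_d_tensor hR hN n).of_equiv (e.symm.rTensor N)

lemma HasRedCxCat.extVanishes_zero [IsNoetherianRing A] (hCM : IsCMLocalRing A)
    (hA : ExtVanishes A A 0) [Module.Finite A N] [Nontrivial N] {M : ModuleCat.{u} A}
    (h : HasRedCxCat A M) (hfin : Module.Finite A M) (hR : R.Acyclic M)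
    (hM : ¬ ExtVanishes A M 0) :
    ExtVanishes A N 0 ∧ ¬ ExtVanishes A (M ⊗[A] N) 0 := by
  induction h with
  | of_finite_pd M h =>
    exact hR.extVanishes_zero_of_hasProjectiveDimensionLT hCM hA
      h.exists_hasProjectiveDimensionLT hM
  | of_step M K t _ _ h _ _ ih =>
    obtain ⟨-, S, _, _, hS, f, g, hf, hg, hfg⟩ := h
    have hfinS : Module.Finite A S := hS.finite
    have : IsNoetherian A K :=
      isNoetherian_of_range_eq_ker f g hfg.linearMap_ker_eq.symm
    have hRS := hS.acyclic hR
    obtain ⟨hN, hK⟩ := ih inferInstance (.middle hf hg hfg hR hRS)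
      (fun hK => hM (.left_zero hf (hK.mem_extKernel_right _)))
    exact ⟨hN, fun hMN => hK (.middle (FlatRes.Acyclic.rTensor_injective hf hg hfg hRS)
      (LinearMap.rTensor_surjective N hg) (rTensor_exact N hfg hg) hMN
      (hS.extVanishes_tensor hR hN hMN))⟩

end ReducibleComplexity

/-- **Proposition 3.7.** Let `A` be a Cohen-Macaulay local ring and `M`, `N` nonzero
finitely generated Tor-independent `A`-modules such that `M` has reducible complexity.
If `depth (M ⊗ N) > 0` then `depth M > 0`. -/
theorem depth_M_pos_of_tensor_depth_pos (A : Type u) [CommRing A] [IsNoetherianRing A]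
    [IsLocalRing A] (hCM : IsCMLocalRing A)
    (M N : Type u) [AddCommGroup M] [Module A M] [AddCommGroup N] [Module A N]
    [Module.Finite A M] [Module.Finite A N]
    (hM : Nontrivial M) (hN : Nontrivial N)
    (hTor : TorIndep A M N)
    (hred : HasReducibleComplexity A M)
    (hpos : 0 < moduleDepth A (TensorProduct A M N)) :
    0 < moduleDepth A M := by
  have hMN : ExtVanishes A (TensorProduct A M N) 0 :=
    extVanishes_of_lt_moduleDepth (by exact_mod_cast hpos)
  rw [moduleDepth_pos_iff]
  by_contra hM₀
  by_cases hA : ExtVanishes A A 0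
  · exact (HasRedCxCat.extVanishes_zero hCM hA hred ‹_› (FlatRes.acyclic_ofProjectiveResolution
      (projectiveResolution (ModuleCat.of A N)) hTor) hM₀).2 hMN
  · have := nontrivial_tensorProduct (A := A) M N
    obtain ⟨d, hd⟩ : ∃ d : ℕ, ringKrullDim A = d := exists_ringKrullDim_eq_natCast A
    obtain rfl : d = 0 := by
      by_contra h0
      exact hA (hCM.extVanishes hd (Nat.pos_of_ne_zero h0))
    obtain ⟨n, hn, hv⟩ := exists_not_extVanishes_le_supportDim (A := A) (X := TensorProduct A M N)
      0 ((Module.supportDim_le_ringKrullDim A _).trans hd.le)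
    obtain rfl : n = 0 := by lia
    exact hv hMN
end
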